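/- Let c₁, c₂ ∈ ℝ and set Ψ₀(ξ) = ξ e^{−ξ²/4}. There exists a function Ψ₁ : [0, ∞) → ℝ, smooth on (0, ∞) with all derivatives extending continuously to ξ = 0, such that Ψ₁(0) = 0, Ψ₁″(ξ) + (ξ/2) Ψ₁′(ξ) + (3/2) Ψ₁(ξ) = c₁ Ψ₀′(ξ) + c₂ Ψ₀‴(ξ) for all ξ > 0, and for every natural number n there exists C_n > 0 with |Ψ₁^{(n)}(ξ)| ≤ C_n e^{−ξ²/8} for all ξ > 0. -/

import Mathlib

open Set

/-- The complementary Gaussian integral `∫_x^∞ e^{-s²/4} ds`. -/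
noncomputable def gaussTail (x : ℝ) : ℝ := ∫ s in Ioi x, Real.exp (-s ^ 2 / 4)

/-- The Mills ratio of the Gaussian `e^{-x²/4}`. -/
noncomputable def millsRatio (x : ℝ) : ℝ := Real.exp (x ^ 2 / 4) * gaussTail x

/-- The primitive of the Mills ratio vanishing at `0`. -/
noncomputable def millsPrimitive (x : ℝ) : ℝ := ∫ s in (0:ℝ)..x, millsRatio s

/-- Combinations, with polynomial coefficients, of the Gaussian, its tail integral, and the
Gaussian times the primitive of the Mills ratio. -/
noncomputable def gaussComb (A B C : Polynomial ℝ) (x : ℝ) : ℝ :=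
  A.eval x * Real.exp (-x ^ 2 / 4) + B.eval x * gaussTail x
    + C.eval x * (millsPrimitive x * Real.exp (-x ^ 2 / 4))

lemma integrable_exp_neg_sq_div_four :
    MeasureTheory.Integrable (fun s : ℝ => Real.exp (-s ^ 2 / 4)) := by
  have h := integrable_exp_neg_mul_sq (b := 1 / 4) (by norm_num)
  refine h.congr (Filter.Eventually.of_forall fun s => ?_)
  simp only
  congr 1
  ring

lemma hasDerivAt_exp_neg_sq_div_four (x : ℝ) :
    HasDerivAt (fun s : ℝ => Real.exp (-s ^ 2 / 4)) (-(x / 2) * Real.exp (-x ^ 2 / 4)) x := by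
  refine ((hasDerivAt_pow 2 x).fun_neg.div_const 4).exp.congr_deriv ?_
  simp
  ring

lemma hasDerivAt_gaussTail (x : ℝ) :
    HasDerivAt gaussTail (-Real.exp (-x ^ 2 / 4)) x := by
  have hc : Continuous fun s : ℝ => Real.exp (-s ^ 2 / 4) := by fun_prop
  have key : gaussTail = fun y => gaussTail 0 - ∫ s in (0:ℝ)..y, Real.exp (-s ^ 2 / 4) := by
    funext y
    rw [eq_sub_iff_add_eq, add_comm]
    exact intervalIntegral.integral_interval_add_Ioi
      integrable_exp_neg_sq_div_four.integrableOn integrable_exp_neg_sq_div_four.integrableOn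
  rw [key]
  exact (hc.integral_hasStrictDerivAt 0 x).hasDerivAt.const_sub _

lemma continuous_gaussTail : Continuous gaussTail :=
  continuous_iff_continuousAt.2 fun x => (hasDerivAt_gaussTail x).continuousAt

lemma continuous_millsRatio : Continuous millsRatio := by
  unfold millsRatio
  have := continuous_gaussTail
  fun_prop

lemma hasDerivAt_millsPrimitive (x : ℝ) : HasDerivAt millsPrimitive (millsRatio x) x :=
  (continuous_millsRatio.integral_hasStrictDerivAt 0 x).hasDerivAt

lemma millsRatio_mul_exp (x : ℝ) : millsRatio x * Real.exp (-x ^ 2 / 4) = gaussTail x := by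
  rw [millsRatio, mul_right_comm, ← Real.exp_add]
  ring_nf
  simp

lemma gaussTail_nonneg (x : ℝ) : 0 ≤ gaussTail x :=
  MeasureTheory.integral_nonneg fun _ => (Real.exp_pos _).le

lemma gaussTail_le {x : ℝ} (hx : 0 ≤ x) :
    gaussTail x ≤ gaussTail 0 * Real.exp (-x ^ 2 / 4) := by
  have h : gaussTail x = ∫ s in Ioi (0:ℝ), Real.exp (-(s + x) ^ 2 / 4) := by
    rw [gaussTail, ← MeasureTheory.integral_indicator measurableSet_Ioi,
      ← MeasureTheory.integral_indicator measurableSet_Ioi,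
      ← MeasureTheory.integral_add_right_eq_self _ x]
    congr 1
    funext s
    simp [indicator]
  rw [h, gaussTail, ← MeasureTheory.integral_mul_const]
  refine MeasureTheory.setIntegral_mono_on
    (integrable_exp_neg_sq_div_four.comp_add_right x).integrableOn
    (integrable_exp_neg_sq_div_four.mul_const _).integrableOn measurableSet_Ioi fun s hs => ?_
  rw [← Real.exp_add, Real.exp_le_exp]
  nlinarith [mul_nonneg (mem_Ioi.1 hs).le hx]

lemma abs_millsRatio_le {x : ℝ} (hx : 0 ≤ x) : |millsRatio x| ≤ gaussTail 0 := by
  rw [millsRatio, abs_of_nonneg (mul_nonneg (Real.exp_pos _).le (gaussTail_nonneg x))]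
  calc Real.exp (x ^ 2 / 4) * gaussTail x
      ≤ Real.exp (x ^ 2 / 4) * (gaussTail 0 * Real.exp (-x ^ 2 / 4)) := by
        gcongr
        exact gaussTail_le hx
    _ = gaussTail 0 := by
        rw [mul_left_comm, ← Real.exp_add]
        ring_nf
        simp

lemma abs_millsPrimitive_le {x : ℝ} (hx : 0 ≤ x) : |millsPrimitive x| ≤ gaussTail 0 * x := by
  have h := intervalIntegral.norm_integral_le_of_norm_le_const (f := millsRatio)
    (a := 0) (b := x) (C := gaussTail 0) fun s hs => by
      rw [uIoc_of_le hx] at hs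
      exact abs_millsRatio_le hs.1.le
  rwa [sub_zero, abs_of_nonneg hx] at h

lemma hasDerivAt_gaussComb (A B C : Polynomial ℝ) (x : ℝ) :
    HasDerivAt (gaussComb A B C)
      (gaussComb (A.derivative - B - Polynomial.C (1 / 2) * Polynomial.X * A)
        (B.derivative + C)
        (C.derivative - Polynomial.C (1 / 2) * Polynomial.X * C) x) x := by
  have hG := hasDerivAt_exp_neg_sq_div_four x
  have h := (((A.hasDerivAt x).mul hG).add ((B.hasDerivAt x).mul (hasDerivAt_gaussTail x))).add
    ((C.hasDerivAt x).mul ((hasDerivAt_millsPrimitive x).mul hG))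
  refine h.congr_deriv ?_
  rw [millsRatio_mul_exp]
  simp [gaussComb]
  ring

lemma deriv_gaussComb (A B C : Polynomial ℝ) :
    deriv (gaussComb A B C) =
      gaussComb (A.derivative - B - Polynomial.C (1 / 2) * Polynomial.X * A)
        (B.derivative + C)
        (C.derivative - Polynomial.C (1 / 2) * Polynomial.X * C) :=
  funext fun x => (hasDerivAt_gaussComb A B C x).deriv

lemma exists_iteratedDeriv_gaussComb (A B C : Polynomial ℝ) (n : ℕ) :
    ∃ P Q R : Polynomial ℝ, iteratedDeriv n (gaussComb A B C) = gaussComb P Q R := by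
  induction n with
  | zero => exact ⟨A, B, C, iteratedDeriv_zero⟩
  | succ n ih =>
    obtain ⟨P, Q, R, h⟩ := ih
    rw [iteratedDeriv_succ, h, deriv_gaussComb]
    exact ⟨_, _, _, rfl⟩

lemma contDiff_gaussComb (A B C : Polynomial ℝ) : ContDiff ℝ (⊤ : ℕ∞) (gaussComb A B C) := by
  refine contDiff_of_differentiable_iteratedDeriv fun n _ => ?_
  obtain ⟨P, Q, R, h⟩ := exists_iteratedDeriv_gaussComb A B C n
  rw [h]
  exact fun x => (hasDerivAt_gaussComb P Q R x).differentiableAt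

lemma exists_abs_eval_le_exp_sq (p : Polynomial ℝ) :
    ∃ K : ℝ, 0 ≤ K ∧ ∀ x : ℝ, 0 ≤ x → |p.eval x| ≤ K * Real.exp (x ^ 2 / 8) := by
  induction p using Polynomial.induction_on' with
  | add p q hp hq =>
    obtain ⟨K, hK, hp⟩ := hp
    obtain ⟨L, hL, hq⟩ := hq
    refine ⟨K + L, add_nonneg hK hL, fun x hx => ?_⟩
    rw [Polynomial.eval_add, add_mul]
    exact (abs_add_le _ _).trans (add_le_add (hp x hx) (hq x hx))
  | monomial n a =>
    refine ⟨|a| * (n.factorial * Real.exp 2), by positivity, fun x hx => ?_⟩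
    have h1 : x ^ n ≤ n.factorial * Real.exp x := by
      have := Real.pow_div_factorial_le_exp x hx n
      rwa [div_le_iff₀' (by positivity)] at this
    have h2 : Real.exp x ≤ Real.exp 2 * Real.exp (x ^ 2 / 8) := by
      rw [← Real.exp_add, Real.exp_le_exp]
      nlinarith [sq_nonneg (x - 4)]
    rw [Polynomial.eval_monomial, abs_mul, abs_of_nonneg (pow_nonneg hx n), mul_assoc, mul_assoc]
    gcongr
    exact h1.trans (by gcongr)

lemma exists_abs_gaussComb_le (A B C : Polynomial ℝ) :
    ∃ K > (0:ℝ), ∀ x > (0:ℝ), |gaussComb A B C x| ≤ K * Real.exp (-x ^ 2 / 8) := by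
  obtain ⟨a, ha, hA⟩ := exists_abs_eval_le_exp_sq A
  obtain ⟨b, hb, hB⟩ := exists_abs_eval_le_exp_sq B
  obtain ⟨c, hc, hC⟩ := exists_abs_eval_le_exp_sq (C * Polynomial.X)
  have hT := gaussTail_nonneg 0
  refine ⟨a + b * gaussTail 0 + c * gaussTail 0 + 1, by positivity, fun x hx => ?_⟩
  have hA := hA x hx.le
  have hB := hB x hx.le
  have hC := hC x hx.le
  rw [Polynomial.eval_mul, Polynomial.eval_X, abs_mul, abs_of_pos hx] at hC
  have hE : |gaussTail x| ≤ gaussTail 0 * Real.exp (-x ^ 2 / 4) := by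
    rw [abs_of_nonneg (gaussTail_nonneg x)]
    exact gaussTail_le hx.le
  have hM := abs_millsPrimitive_le hx.le
  have hexp : Real.exp (x ^ 2 / 8) * Real.exp (-x ^ 2 / 4) = Real.exp (-x ^ 2 / 8) := by
    rw [← Real.exp_add]
    ring_nf
  calc |gaussComb A B C x|
      ≤ |A.eval x| * Real.exp (-x ^ 2 / 4) + |B.eval x| * |gaussTail x|
        + |C.eval x| * (|millsPrimitive x| * Real.exp (-x ^ 2 / 4)) := by
        refine (abs_add_three _ _ _).trans_eq ?_
        simp only [abs_mul, Real.abs_exp]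
    _ ≤ |A.eval x| * Real.exp (-x ^ 2 / 4)
        + |B.eval x| * (gaussTail 0 * Real.exp (-x ^ 2 / 4))
        + |C.eval x| * (gaussTail 0 * x * Real.exp (-x ^ 2 / 4)) := by gcongr
    _ = (|A.eval x| + |B.eval x| * gaussTail 0 + |C.eval x| * x * gaussTail 0)
        * Real.exp (-x ^ 2 / 4) := by ring
    _ ≤ (a * Real.exp (x ^ 2 / 8) + b * Real.exp (x ^ 2 / 8) * gaussTail 0
        + c * Real.exp (x ^ 2 / 8) * gaussTail 0) * Real.exp (-x ^ 2 / 4) := by gcongr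
    _ = (a + b * gaussTail 0 + c * gaussTail 0)
        * (Real.exp (x ^ 2 / 8) * Real.exp (-x ^ 2 / 4)) := by ring
    _ ≤ (a + b * gaussTail 0 + c * gaussTail 0 + 1) * Real.exp (-x ^ 2 / 8) := by
        rw [hexp]
        exact mul_le_mul_of_nonneg_right (by linarith) (Real.exp_pos _).le

/-- Lemma 2.3: existence of the first-order correction `Ψ₁` in the expansion of the
diffusive tail, solving `(L_Δ + 1/2)Ψ₁ = c₁Ψ₀' + c₂Ψ₀'''` with Dirichlet condition and
Gaussian bounds on all derivatives; here `Ψ₀(ξ) = ξ e^{-ξ²/4}`. -/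
theorem stmt_9 (c₁ c₂ : ℝ) :
    ∃ Ψ₁ : ℝ → ℝ,
      ContDiffOn ℝ (⊤ : ℕ∞) Ψ₁ (Ioi (0:ℝ)) ∧
      (∀ n : ℕ, ∃ l : ℝ,
        Filter.Tendsto (iteratedDeriv n Ψ₁) (nhdsWithin 0 (Ioi (0:ℝ))) (nhds l)) ∧
      Ψ₁ 0 = 0 ∧
      (∀ ξ > (0:ℝ),
        iteratedDeriv 2 Ψ₁ ξ + (ξ / 2) * deriv Ψ₁ ξ + (3/2) * Ψ₁ ξ
          = c₁ * deriv (fun ζ => ζ * Real.exp (-ζ ^ 2 / 4)) ξ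
            + c₂ * iteratedDeriv 3 (fun ζ => ζ * Real.exp (-ζ ^ 2 / 4)) ξ) ∧
      ∀ n : ℕ, ∃ Cn > (0:ℝ), ∀ ξ > (0:ℝ),
        |iteratedDeriv n Ψ₁ ξ| ≤ Cn * Real.exp (-ξ ^ 2 / 8) := by
  have hsource : (fun ζ : ℝ => ζ * Real.exp (-ζ ^ 2 / 4)) = gaussComb Polynomial.X 0 0 := by
    funext ζ
    simp [gaussComb]
  set A : Polynomial ℝ := Polynomial.C (-c₁) * Polynomial.X ^ 2
    + Polynomial.C c₂ * (Polynomial.C (1 / 8) * Polynomial.X ^ 4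
      - Polynomial.C (3 / 4) * Polynomial.X ^ 2) with hA
  set B : Polynomial ℝ := Polynomial.C (-c₁) * Polynomial.X with hB
  set C : Polynomial ℝ := Polynomial.C (-c₁) * (1 - Polynomial.C (1 / 2) * Polynomial.X ^ 2)
    with hC
  refine ⟨gaussComb A B C, (contDiff_gaussComb A B C).contDiffOn, fun n => ?_, ?_,
    fun ξ _ => ?_, fun n => ?_⟩
  · obtain ⟨P, Q, R, h⟩ := exists_iteratedDeriv_gaussComb A B C n
    rw [h]
    exact ⟨_, (hasDerivAt_gaussComb P Q R 0).continuousAt.tendsto.mono_left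
      nhdsWithin_le_nhds⟩
  · simp [gaussComb, millsPrimitive, hA, hB]
  · simp only [hsource, iteratedDeriv_succ, iteratedDeriv_zero, deriv_gaussComb]
    simp [gaussComb, hA, hB, hC]
    ring
  · obtain ⟨P, Q, R, h⟩ := exists_iteratedDeriv_gaussComb A B C n
    rw [h]
    exact exists_abs_gaussComb_le P Q R
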